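/- arXiv:1107.4849 — 3 statements merged into one kernel-verified Lean document; each statement's English description precedes it below -/
import Mathlib

section
/- Let K be a field of characteristic p > 0, let n ≥ 1 be an integer with p ∤ n, let ζ ∈ K be a primitive n-th root of unity, let λ ∈ ℤ and let k ≥ 1. Then the minimal polynomial of the matrix J(ζ^λ,k)^n over K is (X − 1)^k. (Key step in the proof of Proposition 2.2: all eigenvalues of A^n are 1 and its minimal polynomial is (x−1)^k.) -/
/-- The Jordan block `J(μ,k)`: the `k × k` matrix with all diagonal entries `μ`,
all superdiagonal entries `1`, and all other entries `0`. -/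
def jordanBlock (K : Type*) [CommRing K] (μ : K) (k : ℕ) : Matrix (Fin k) (Fin k) K :=
  Matrix.of fun i j => if i = j then μ else if (i : ℕ) + 1 = (j : ℕ) then 1 else 0

open Polynomial

theorem jordanBlock_sub_algebraMap_pow_apply {K : Type*} [CommRing K] (μ : K) (k m : ℕ)
    (i j : Fin k) :
    ((jordanBlock K μ k - algebraMap K _ μ) ^ m) i j = if (i : ℕ) + m = j then 1 else 0 := by
  induction m generalizing i with
  | zero => simp [Matrix.one_apply, Fin.ext_iff]
  | succ m ih =>
    have entry (l : Fin k) : (jordanBlock K μ k - algebraMap K _ μ) i l =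
        if (i : ℕ) + 1 = l then 1 else 0 := by
      rw [Matrix.sub_apply, Matrix.algebraMap_matrix_apply, jordanBlock, Matrix.of_apply]
      by_cases h : i = l <;> simp [h]
    simp only [pow_succ', Matrix.mul_apply, entry, ih, ite_mul, one_mul, zero_mul]
    by_cases h : (i : ℕ) + 1 < k
    · rw [Finset.sum_eq_single ⟨i + 1, h⟩]
      · simp [add_assoc, add_comm 1 m]
      · intro l _ hl
        rw [if_neg fun h' => hl (Fin.ext h'.symm)]
      · simp
    · rw [Finset.sum_eq_zero fun l _ => if_neg (by lia), if_neg (by lia)]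

theorem jordanBlock_sub_algebraMap_pow_eq_zero_iff {K : Type*} [CommRing K] [Nontrivial K]
    (μ : K) (k m : ℕ) : (jordanBlock K μ k - algebraMap K _ μ) ^ m = 0 ↔ k ≤ m := by
  constructor
  · intro h
    by_contra! hm
    have := jordanBlock_sub_algebraMap_pow_apply μ k m ⟨0, by lia⟩ ⟨m, hm⟩
    simp [h] at this
  · intro h
    ext i j
    rw [jordanBlock_sub_algebraMap_pow_apply, if_neg (by lia), Matrix.zero_apply]

theorem minpoly_eq_X_sub_C_pow {K A : Type*} [Field K] [Ring A] [Algebra K A] {a : A} {μ : K}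
    {k : ℕ} (h : ∀ m, (a - algebraMap K A μ) ^ m = 0 ↔ k ≤ m) :
    minpoly K a = (X - C μ) ^ k := by
  have monic (m : ℕ) : ((X - C μ) ^ m).Monic := (monic_X_sub_C μ).pow m
  have aeval_eq (m : ℕ) : aeval a ((X - C μ) ^ m) = (a - algebraMap K A μ) ^ m := by simp
  have hk : aeval a ((X - C μ) ^ k) = 0 := by rw [aeval_eq, h]
  obtain ⟨m, hmk, hm⟩ := (dvd_prime_pow (prime_X_sub_C μ) k).1 (minpoly.dvd K a hk)
  have eq : minpoly K a = (X - C μ) ^ m :=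
    eq_of_monic_of_associated (minpoly.monic ⟨_, monic k, hk⟩) (monic m) hm
  have hkm : k ≤ m := by rw [← h, ← aeval_eq, ← eq, minpoly.aeval]
  rw [eq, hmk.antisymm hkm]

/-- If `q` is coprime to `X - μ` and `a - μ` is nilpotent, then `q(a)` is a unit, so `(a - μ) q(a)`
and `a - μ` have the same vanishing powers. -/
theorem aeval_pow_eq_zero_iff_of_isCoprime {K A : Type*} [CommRing K] [Ring A] [Algebra K A]
    {a : A} {μ : K} {q : K[X]} (hq : IsCoprime (X - C μ) q)
    (ha : IsNilpotent (a - algebraMap K A μ)) (m : ℕ) :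
    aeval a ((X - C μ) * q) ^ m = 0 ↔ (a - algebraMap K A μ) ^ m = 0 := by
  obtain ⟨k, hk⟩ := ha
  obtain ⟨u, v, huv⟩ := hq.pow (m := k) (n := m)
  have hunit : aeval a (q ^ m) * aeval a v = 1 := by
    have := congrArg (aeval a) huv
    rw [mul_comm v] at this
    simpa [hk] using this
  have : IsUnit (aeval a (q ^ m)) := by
    refine ⟨⟨_, aeval a v, hunit, ?_⟩, rfl⟩
    rw [← map_mul, mul_comm, map_mul, hunit]
  rw [← map_pow, mul_pow, map_mul, this.mul_left_eq_zero]
  simp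

/-- If `ζ` is a primitive `n`-th root of unity in a field `K` of characteristic `p` with
`p ∤ n`, then the minimal polynomial of `J(ζ^λ,k)^n` is `(X - 1)^k`. -/
theorem minpoly_jordanBlock_pow_n (K : Type*) [Field K] (p : ℕ) [Fact p.Prime] [CharP K p]
    (n : ℕ) (hn : 1 ≤ n) (hpn : ¬ p ∣ n) (ζ : K) (hζ : IsPrimitiveRoot ζ n)
    (l : ℤ) (k : ℕ) (hk : 1 ≤ k) :
    minpoly K ((jordanBlock K (ζ ^ l) k) ^ n) = (Polynomial.X - 1 : Polynomial K) ^ k := by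
  have hn0 : (n : K) ≠ 0 := fun h => hpn ((CharP.cast_eq_zero_iff K p n).1 h)
  set μ : K := ζ ^ l
  have hμ : μ ^ n = 1 := by
    rw [← zpow_natCast, zpow_comm, zpow_natCast, hζ.pow_eq_one, one_zpow]
  obtain ⟨q, hq⟩ : X - C μ ∣ (X ^ n - 1 : K[X]) := dvd_iff_isRoot.2 (by simp [hμ])
  have hsep : (X ^ n - 1 : K[X]).Separable := X_pow_sub_one_separable_iff.2 hn0
  rw [hq] at hsep
  rw [← C_1]
  refine minpoly_eq_X_sub_C_pow fun m => ?_
  have hpow : jordanBlock K μ k ^ n - algebraMap K _ 1 =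
      aeval (jordanBlock K μ k) ((X - C μ) * q) := by
    rw [← hq]
    simp
  rw [hpow, aeval_pow_eq_zero_iff_of_isCoprime hsep.isCoprime
    ⟨k, (jordanBlock_sub_algebraMap_pow_eq_zero_iff μ k k).2 le_rfl⟩,
    jordanBlock_sub_algebraMap_pow_eq_zero_iff]
end

section
/- Let K be a field of characteristic p > 0, let n ≥ 1 be an integer with p ∤ n, let ζ ∈ K be a primitive n-th root of unity, let λ ∈ ℤ and let k ≥ 1. Then the matrix J(ζ^λ,k)^n is similar over K (i.e. conjugate by an invertible k×k matrix over K) to the unipotent Jordan block J(1,k). (This is the second half of Proposition 2.2: V(λ,k) seen as a module over the p-part P = ⟨g^n⟩ is indecomposable and isomorphic to K[P]/(σ−1)^k.) -/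
open Polynomial in
/-- A polynomial in the nilpotent Jordan block is the upper triangular Toeplitz matrix of its
coefficients. -/
theorem aeval_jordanBlock_zero_apply {K : Type*} [CommRing K] {k : ℕ} (f : K[X]) (i j : Fin k) :
    aeval (jordanBlock K 0 k) f i j =
      if (i : ℕ) ≤ j then f.coeff ((j : ℕ) - i) else 0 := by
  have hpow (m : ℕ) (i j : Fin k) :
      (jordanBlock K 0 k ^ m) i j = if (i : ℕ) + m = j then 1 else 0 := by
    induction m generalizing i with
    | zero => simp [Matrix.one_apply, Fin.ext_iff]
    | succ m ih =>
      rw [pow_succ', Matrix.mul_apply]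
      by_cases hi : (i : ℕ) + 1 < k
      · rw [Finset.sum_eq_single ⟨i + 1, hi⟩]
        · rw [ih]
          simp [jordanBlock, Fin.ext_iff, show (i : ℕ) + 1 + m = i + (m + 1) by omega]
        · intro b _ hb
          have : (i : ℕ) + 1 ≠ b := fun h => hb (Fin.ext h.symm)
          simp [jordanBlock, this]
        · simp
      · rw [if_neg (by omega)]
        refine Finset.sum_eq_zero fun b _ => ?_
        have : (i : ℕ) + 1 ≠ b := by omega
        simp [jordanBlock, this]
  induction f using Polynomial.induction_on' with
  | add f g hf hg => simp only [map_add, Matrix.add_apply, hf, hg, coeff_add]; split_ifs <;> simp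
  | monomial m a =>
    rw [aeval_monomial, ← Algebra.smul_def, Matrix.smul_apply, hpow, coeff_monomial]
    split_ifs <;> first | omega | simp

/-- A Jordan block is the nilpotent Jordan block plus a scalar. -/
theorem jordanBlock_eq_add_algebraMap {K : Type*} [CommRing K] (μ : K) (k : ℕ) :
    jordanBlock K μ k = jordanBlock K 0 k + algebraMap K _ μ := by
  ext i j
  by_cases h : i = j <;> simp [jordanBlock, h, Matrix.algebraMap_matrix_apply]

open Polynomial in
/-- If `q` has invertible constant coefficient and `N` is the nilpotent Jordan block, then
`N * q(N)` is similar to `N`. -/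
theorem exists_aeval_X_mul_jordanBlock_zero_eq {K : Type*} [CommRing K] (k : ℕ) (q : K[X])
    (hq : IsUnit (q.coeff 0)) :
    ∃ P : (Matrix (Fin k) (Fin k) K)ˣ,
      aeval (jordanBlock K 0 k) (X * q) =
        (P : Matrix (Fin k) (Fin k) K) * jordanBlock K 0 k *
          ((P⁻¹ : (Matrix (Fin k) (Fin k) K)ˣ) : Matrix (Fin k) (Fin k) K) := by
  let P : Matrix (Fin k) (Fin k) K :=
    Matrix.of fun i j => aeval (jordanBlock K 0 k) (q ^ (k - 1 - (j : ℕ))) i j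
  have htri : P.IsUpperTriangular := by
    intro i j hij
    have : ¬ (i : ℕ) ≤ j := not_le.mpr hij
    simp only [P, Matrix.of_apply, aeval_jordanBlock_zero_apply, if_neg this]
  have hP : IsUnit P := by
    rw [Matrix.isUnit_iff_isUnit_det, Matrix.det_of_isUpperTriangular htri, IsUnit.prod_iff]
    intro i _
    simpa [P, aeval_jordanBlock_zero_apply, coeff_zero_eq_eval_zero, -map_pow] using
      (coeff_zero_eq_eval_zero q ▸ hq).pow (k - 1 - (i : ℕ))
  refine ⟨hP.unit, ?_⟩
  rw [Units.eq_mul_inv_iff_mul_eq, IsUnit.unit_spec]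
  ext i j
  have hcol : (aeval (jordanBlock K 0 k) (X * q) * P) i j =
      aeval (jordanBlock K 0 k) (X * q ^ (k - (j : ℕ))) i j := by
    have : X * q ^ (k - (j : ℕ)) = X * q * q ^ (k - 1 - (j : ℕ)) := by
      rw [mul_assoc, ← pow_succ']
      congr 2
      omega
    rw [this, map_mul _ (X * q), Matrix.mul_apply, Matrix.mul_apply]
    rfl
  rw [hcol, aeval_jordanBlock_zero_apply, Matrix.mul_apply]
  rcases Nat.eq_zero_or_pos (j : ℕ) with hj | hj
  · rw [Finset.sum_eq_zero]
    · simp [hj]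
    · intro b _
      simp [jordanBlock, hj]
  · rw [Finset.sum_eq_single ⟨j - 1, by omega⟩]
    · have h1 : (j : ℕ) - 1 + 1 = j := by omega
      have h2 : k - 1 - ((j : ℕ) - 1) = k - j := by omega
      have h3 : jordanBlock K 0 k ⟨j - 1, by omega⟩ j = 1 := by
        simp [jordanBlock, h1, Fin.ext_iff, show (j : ℕ) - 1 ≠ j by omega]
      simp only [h3, mul_one, P, Matrix.of_apply, aeval_jordanBlock_zero_apply, h2]
      rcases lt_trichotomy (i : ℕ) j with h | h | h
      · have h4 : (j : ℕ) - i = (j - 1 - i) + 1 := by omega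
        rw [if_pos h.le, if_pos (by omega), h4, coeff_X_mul]
      · rw [if_pos h.le, if_neg (by omega), h, Nat.sub_self, coeff_X_mul_zero]
      · rw [if_neg (by omega), if_neg (by omega)]
    · intro b _ hb
      have : (b : ℕ) + 1 ≠ j := fun h => hb (Fin.ext (Nat.eq_sub_of_add_eq h))
      simp [jordanBlock, this]
    · simp

/-- If `ζ` is a primitive `n`-th root of unity in a field `K` of characteristic `p` with
`p ∤ n`, then `J(ζ^λ,k)^n` is similar over `K` to the unipotent Jordan block `J(1,k)`. -/
theorem jordanBlock_pow_n_similar (K : Type*) [Field K] (p : ℕ) [Fact p.Prime] [CharP K p]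
    (n : ℕ) (hn : 1 ≤ n) (hpn : ¬ p ∣ n) (ζ : K) (hζ : IsPrimitiveRoot ζ n)
    (l : ℤ) (k : ℕ) (hk : 1 ≤ k) :
    ∃ P : (Matrix (Fin k) (Fin k) K)ˣ,
      (jordanBlock K (ζ ^ l) k) ^ n =
        (P : Matrix (Fin k) (Fin k) K) * jordanBlock K 1 k * ((P⁻¹ : (Matrix (Fin k) (Fin k) K)ˣ) : Matrix (Fin k) (Fin k) K) := by
  open Polynomial in
  set μ := ζ ^ l with hμ_def
  have hμ : μ ^ n = 1 := by
    rw [hμ_def, ← zpow_natCast, zpow_comm, zpow_natCast, hζ.pow_eq_one, one_zpow]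
  have hμ0 : μ ≠ 0 := zpow_ne_zero l (hζ.ne_zero (by omega))
  obtain ⟨P, hP⟩ := exists_aeval_X_mul_jordanBlock_zero_eq k ((X + C μ) ^ n).divX (by
    rw [coeff_divX, coeff_X_add_C_pow, isUnit_iff_ne_zero]
    simpa [hμ0, CharP.cast_eq_zero_iff K p] using hpn)
  refine ⟨P, ?_⟩
  have hdiv : (X + C μ) ^ n = X * ((X + C μ) ^ n).divX + 1 := by
    conv_lhs => rw [← X_mul_divX_add ((X + C μ) ^ n)]
    rw [coeff_X_add_C_pow]
    simp [hμ]
  have hpow := congrArg (aeval (jordanBlock K 0 k)) hdiv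
  rw [map_add, hP, map_pow, map_add, aeval_X, aeval_C, map_one,
    ← jordanBlock_eq_add_algebraMap] at hpow
  rw [hpow, jordanBlock_eq_add_algebraMap 1 k, map_one, mul_add, add_mul, mul_one, Units.mul_inv]
end

section
/- Let n be a positive integer, let α be an integer, let t₀ ≤ t be natural numbers, and for j = 1,…,t let e_j be a positive integer, Φ_j an integer, and for j = t₀+1,…,t let ν_j be an integer. Then, as rational numbers, Σ_{j=1}^{t₀} ( ⌊ αΦ_j/e_j + (e_j − 1)/e_j ⌋ − αΦ_j/e_j ) + Σ_{j=t₀+1}^{t} ( ⌊ αΦ_j/e_j + ν_j/n + (e_j − 1)/e_j ⌋ − αΦ_j/e_j ) = Σ_{j=1}^{t} ⟨ −αΦ_j/e_j ⟩ + Σ_{j=t₀+1}^{t} ⌊ ⟨ (αΦ_j − 1)/e_j ⟩ + ν_j/n ⌋. (This is the arithmetic content of Lemma 3.8: the degree of the effective divisor E_{k,λ} — whose coefficients are the bracketed floor expressions and where deg A = −Σ_j Φ_j/e_j — equals the Boseck invariant Γ_{k,λ}.) -/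
/-- For integers `a` and `e > 0`, `⌈a / e⌉ = ⌊(a - 1) / e⌋ + 1`. -/
theorem ceil_intCast_div_eq_floor_add_one (a e : ℤ) (he : 0 < e) :
    ⌈(a : ℚ) / (e : ℚ)⌉ = ⌊((a : ℚ) - 1) / (e : ℚ)⌋ + 1 := by
  have he' : (0 : ℚ) < e := by exact_mod_cast he
  rw [Int.ceil_eq_iff]
  constructor
  · have h := Int.floor_le (((a : ℚ) - 1) / (e : ℚ))
    have h' : ((a : ℚ) - 1) / e < a / e := by gcongr; linarith
    push_cast
    linarith
  · have h := Int.lt_floor_add_one (((a : ℚ) - 1) / (e : ℚ))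
    rw [div_lt_iff₀ he'] at h
    rw [div_le_iff₀ he']
    have h' : a - 1 < (⌊((a : ℚ) - 1) / (e : ℚ)⌋ + 1) * e := by exact_mod_cast h
    exact_mod_cast Int.sub_one_lt_iff.mp h'

theorem fract_neg_intCast_div (a e : ℤ) (he : 0 < e) :
    Int.fract (-(a : ℚ) / (e : ℚ)) = ⌊((a : ℚ) - 1) / (e : ℚ)⌋ + 1 - (a : ℚ) / e := by
  rw [Int.fract, neg_div, Int.floor_neg, ceil_intCast_div_eq_floor_add_one a e he]
  push_cast
  ring

theorem floor_intCast_div_add_sub_intCast_div (a e : ℤ) (he : 0 < e) (y : ℚ) :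
    (⌊(a : ℚ) / e + y + ((e : ℚ) - 1) / e⌋ : ℚ) - (a : ℚ) / e =
      Int.fract (-(a : ℚ) / (e : ℚ)) + ⌊Int.fract (((a : ℚ) - 1) / e) + y⌋ := by
  have he' : (e : ℚ) ≠ 0 := by exact_mod_cast he.ne'
  have h : (a : ℚ) / e + y + ((e : ℚ) - 1) / e =
      Int.fract (((a : ℚ) - 1) / e) + y + ((⌊((a : ℚ) - 1) / e⌋ + 1 : ℤ) : ℚ) := by
    rw [Int.fract]
    push_cast
    field_simp
    ring
  rw [h, Int.floor_add_intCast, fract_neg_intCast_div a e he]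
  push_cast
  ring


/-- The degree of the effective divisor `E_{k,λ}` equals the Boseck invariant `Γ_{k,λ}`:
`Σ_{j=1}^{t₀} (⌊αΦ_j/e_j + (e_j - 1)/e_j⌋ - αΦ_j/e_j)
 + Σ_{j=t₀+1}^{t} (⌊αΦ_j/e_j + ν_j/n + (e_j - 1)/e_j⌋ - αΦ_j/e_j)
 = Σ_{j=1}^{t} ⟨-αΦ_j/e_j⟩ + Σ_{j=t₀+1}^{t} ⌊⟨(αΦ_j - 1)/e_j⟩ + ν_j/n⌋`. -/
theorem deg_E_eq_boseck (n : ℕ) (hn : 0 < n) (α : ℤ) (t₀ t : ℕ) (ht : t₀ ≤ t)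
    (e : ℕ → ℤ) (he : ∀ j, 0 < e j) (Φ : ℕ → ℤ) (ν : ℕ → ℤ) :
    (∑ j ∈ Finset.Icc 1 t₀,
        (((⌊((α * Φ j : ℤ) : ℚ) / ((e j : ℤ) : ℚ) + (((e j : ℤ) : ℚ) - 1) / ((e j : ℤ) : ℚ)⌋ : ℤ) : ℚ)
          - ((α * Φ j : ℤ) : ℚ) / ((e j : ℤ) : ℚ))) +
      (∑ j ∈ Finset.Icc (t₀ + 1) t,
        (((⌊((α * Φ j : ℤ) : ℚ) / ((e j : ℤ) : ℚ) + ((ν j : ℤ) : ℚ) / (n : ℚ)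
              + (((e j : ℤ) : ℚ) - 1) / ((e j : ℤ) : ℚ)⌋ : ℤ) : ℚ)
          - ((α * Φ j : ℤ) : ℚ) / ((e j : ℤ) : ℚ))) =
    (∑ j ∈ Finset.Icc 1 t, Int.fract (-((α * Φ j : ℤ) : ℚ) / ((e j : ℤ) : ℚ))) +
      (∑ j ∈ Finset.Icc (t₀ + 1) t,
        ((⌊Int.fract ((((α * Φ j : ℤ) : ℚ) - 1) / ((e j : ℤ) : ℚ)) + ((ν j : ℤ) : ℚ) / (n : ℚ)⌋ : ℤ) : ℚ)) := by
  have hsplit : Finset.Icc 1 t = Finset.Icc 1 t₀ ∪ Finset.Icc (t₀ + 1) t := by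
    ext j
    simp only [Finset.mem_union, Finset.mem_Icc]
    omega
  have hdisj : Disjoint (Finset.Icc 1 t₀) (Finset.Icc (t₀ + 1) t) := by
    rw [Finset.disjoint_left]
    intro j
    simp only [Finset.mem_Icc]
    omega
  rw [hsplit, Finset.sum_union hdisj, add_assoc, ← Finset.sum_add_distrib]
  congr 1
  · refine Finset.sum_congr rfl fun j _ => ?_
    simpa using floor_intCast_div_add_sub_intCast_div (α * Φ j) (e j) (he j) 0
  · exact Finset.sum_congr rfl fun j _ =>
      floor_intCast_div_add_sub_intCast_div (α * Φ j) (e j) (he j) _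
end
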